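/- Let ν = (ν_1 > ν_2 > ⋯ > ν_r > 0) be a strict partition of length r ≤ n and define the K-theoretic P-polynomial GP_ν(x_n) := Σ_{w∈C(r,n)} w·( ∏_{i=1}^{r} x_i^{ν_i} · ∏_{i=1}^{r} ∏_{j=i+1}^{n} (x_i ⊕ x_j)/(x_i ⊖ x_j) ). Then GP_ν(x_n) = [u_1^{−ν_1}⋯u_r^{−ν_r}]( ∏_{i=1}^{r} ( (1/(2+βu_i)) · (1/(1+βu_i)) · ∏_{j=1}^{n} (u_i ⊕ x_j)/(u_i ⊖ x_j) ) · ∏_{1≤i<j≤r} (u_j ⊖ u_i)/(u_j ⊕ u_i) ), the coefficient being taken in Λ[[β]], where 1/(2+βu_i) = (1/2) Σ_{k≥0} (−βu_i/2)^k and u_i/(u_i ⊕ u_i) = 1/(2+βu_i). This is the multiplicative specialization of the generating-function theorem for the universal Schur P-functions. -/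

import Mathlib

open Finset

noncomputable section

instance finWF (r : ℕ) : WellFoundedLT (Fin r) :=
  inferInstanceAs (IsWellFounded (Fin r) (· < ·))

/-- The field `ℚ(x_1, …, x_n)` of rational functions. -/
abbrev K (n : ℕ) : Type := FractionRing (MvPolynomial (Fin n) ℚ)

/-- The indeterminate `x_i` (`0`-indexed). -/
def x (n : ℕ) (i : Fin n) : K n :=
  algebraMap (MvPolynomial (Fin n) ℚ) (K n) (MvPolynomial.X i)

/-- The coset representatives `C(r,n)`. -/
def Cperm (r n : ℕ) : Finset (Equiv.Perm (Fin n)) :=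
  Finset.univ.filter fun w => ∀ i j : Fin n, r ≤ (i : ℕ) → i < j → w i < w j

/-- The ring `Λ[[β]]`, where `Λ = K((u_1⁻¹))⋯((u_r⁻¹))`, realized inside the Hahn series
field over the lexicographically ordered group `ℤ^{r+1}` (coordinate `0` is the exponent of
the power series variable `β` and is the most significant). -/
abbrev H (n r : ℕ) := HahnSeries (Lex (Fin (r + 1) → ℤ)) (K n)

/-- The formal power series variable `β`. -/
def β (n r : ℕ) : H n r :=
  HahnSeries.single (toLex (Pi.single (0 : Fin (r + 1)) (1 : ℤ))) 1

/-- The variable `u_i` (`0`-indexed). -/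
def u (n r : ℕ) (i : Fin r) : H n r :=
  HahnSeries.single (toLex (Pi.single (Fin.succ (Fin.rev i)) (-1 : ℤ))) 1

/-- The formal sum `a ⊕ b = a + b + βab`. -/
def fplus (n r : ℕ) (a c : H n r) : H n r := a + c + β n r * a * c

/-- The formal difference `a ⊖ b = (a − b)/(1 + βb)`. -/
def fminus (n r : ℕ) (a c : H n r) : H n r := (a - c) / (1 + β n r * c)

/-- The image of a rational function in the Hahn field. -/
abbrev CK {n r : ℕ} (a : K n) : H n r := HahnSeries.C a

/-- The exponent-vector of `β^d · u_1^{−g(1)} ⋯ u_r^{−g(r)}`. -/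
def eVec (r : ℕ) (d : ℤ) (g : Fin r → ℤ) : Lex (Fin (r + 1) → ℤ) :=
  toLex (Fin.cases d (fun j => g (Fin.rev j)))

section Support

variable {Γ F : Type*} [AddCommGroup Γ] [LinearOrder Γ] [IsOrderedAddMonoid Γ] [Field F]

/-- The subring of Hahn series whose support lies in a submonoid `A` of the exponents. -/
def suppSubring (F : Type*) [Field F] (A : AddSubmonoid Γ) : Subring (HahnSeries Γ F) where
  carrier := {a | ∀ g, a.coeff g ≠ 0 → g ∈ A}
  mul_mem' := by
    intro a b ha hb g hg
    obtain ⟨p, hp, q, hq, rfl⟩ := HahnSeries.support_mul_subset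
      ((HahnSeries.mem_support _ _).2 hg)
    exact A.add_mem (ha _ hp) (hb _ hq)
  one_mem' := by
    intro g hg
    rw [HahnSeries.coeff_one] at hg
    have : g = 0 := by by_contra h; simp [h] at hg
    exact this ▸ A.zero_mem
  add_mem' := by
    intro a b ha hb g hg
    by_cases h : a.coeff g = 0
    · exact hb g fun h' => hg (by simp [h, h'])
    · exact ha g h
  zero_mem' := by intro g hg; simp at hg
  neg_mem' := by intro a ha g hg; exact ha g (by simpa using hg)

theorem suppSubring_mono {A B : AddSubmonoid Γ} (h : A ≤ B) :
    suppSubring F A ≤ suppSubring F B := fun _ ha g hg => h (ha g hg)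

theorem single_mem_suppSubring {A : AddSubmonoid Γ} {g : Γ} (hg : g ∈ A) (c : F) :
    HahnSeries.single g c ∈ suppSubring F A := by
  intro g' hg'
  have : g' = g := by
    by_contra h
    exact hg' (HahnSeries.coeff_single_of_ne h)
  exact this ▸ hg

theorem hsum_powers_mem_suppSubring {A : AddSubmonoid Γ} {y : HahnSeries Γ F}
    (hy : y ∈ suppSubring F A) :
    (HahnSeries.SummableFamily.powers y).hsum ∈ suppSubring F A := by
  intro g hg
  obtain ⟨k, hk⟩ := Set.mem_iUnion.1 (HahnSeries.SummableFamily.support_hsum_subset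
    ((HahnSeries.mem_support _ _).2 hg))
  by_cases h : 0 < y.orderTop
  · rw [HahnSeries.SummableFamily.powers_of_orderTop_pos h] at hk
    exact (suppSubring F A).pow_mem hy k g hk
  · rw [HahnSeries.SummableFamily.powers_of_not_orderTop_pos h] at hk
    by_cases hk0 : k = 0
    · subst hk0
      exact (suppSubring F A).one_mem g (by simpa using hk)
    · simp [hk0] at hk

theorem one_sub_ne_zero_of_orderTop_pos {y : HahnSeries Γ F} (h : 0 < y.orderTop) :
    1 - y ≠ 0 :=
  left_ne_zero_of_mul_eq_one (HahnSeries.SummableFamily.one_sub_self_mul_hsum_powers h)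

theorem inv_one_sub_mem_suppSubring {A : AddSubmonoid Γ} {y : HahnSeries Γ F}
    (hy : y ∈ suppSubring F A) (h : 0 < y.orderTop) : (1 - y)⁻¹ ∈ suppSubring F A := by
  rw [inv_eq_of_mul_eq_one_right (HahnSeries.SummableFamily.one_sub_self_mul_hsum_powers h)]
  exact hsum_powers_mem_suppSubring hy

theorem inv_mem_suppSubring (A : AddSubgroup Γ) {a : HahnSeries Γ F}
    (ha : a ∈ suppSubring F A.toAddSubmonoid) : a⁻¹ ∈ suppSubring F A.toAddSubmonoid := by
  by_cases h0 : a = 0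
  · simp [h0]
  have ho : -a.order ∈ A := A.neg_mem (ha _ (HahnSeries.coeff_order_eq_zero.not.2 h0))
  have hs := single_mem_suppSubring (F := F) (A := A.toAddSubmonoid) ho a.leadingCoeff⁻¹
  rw [HahnSeries.inv_def]
  exact (suppSubring F _).mul_mem hs (hsum_powers_mem_suppSubring
    ((suppSubring F _).sub_mem (suppSubring F _).one_mem ((suppSubring F _).mul_mem hs ha)))

/-- The subfield of Hahn series whose support lies in a subgroup `A` of the exponents. -/
def suppSubfield (F : Type*) [Field F] (A : AddSubgroup Γ) : Subfield (HahnSeries Γ F) where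
  __ := suppSubring F A.toAddSubmonoid
  inv_mem' := fun _ ha => inv_mem_suppSubring A ha

/-- `OffSupport A a` says that no exponent of `a` lies in `A`. -/
def OffSupport (A : AddSubgroup Γ) (a : HahnSeries Γ F) : Prop := ∀ g ∈ A, a.coeff g = 0

omit [IsOrderedAddMonoid Γ] in
theorem OffSupport.add {A : AddSubgroup Γ} {a b : HahnSeries Γ F} (ha : OffSupport A a)
    (hb : OffSupport A b) : OffSupport A (a + b) := fun g hg => by
  simp [ha g hg, hb g hg]

omit [IsOrderedAddMonoid Γ] in
theorem OffSupport.sum {ι : Type*} {A : AddSubgroup Γ} {s : Finset ι} {a : ι → HahnSeries Γ F}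
    (ha : ∀ i ∈ s, OffSupport A (a i)) : OffSupport A (∑ i ∈ s, a i) :=
  Finset.sum_induction a (OffSupport A) (fun _ _ => OffSupport.add) (fun g _ => by simp) ha

theorem OffSupport.mul_left {A : AddSubgroup Γ} {a b : HahnSeries Γ F}
    (ha : a ∈ suppSubfield F A) (hb : OffSupport A b) : OffSupport A (a * b) := by
  intro g hg
  by_contra h
  obtain ⟨p, hp, q, hq, rfl⟩ := HahnSeries.support_mul_subset
    ((HahnSeries.mem_support _ _).2 h)
  have hpA : p ∈ A := ha p hp
  exact hq (hb q ((A.add_mem_cancel_left hpA).1 hg))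

theorem offSupport_single_mul {A : AddSubgroup Γ} {B : AddSubmonoid Γ} {g₀ : Γ} {c : F}
    (h : ∀ b ∈ B, g₀ + b ∉ A) {a : HahnSeries Γ F} (ha : a ∈ suppSubring F B) :
    OffSupport A (HahnSeries.single g₀ c * a) := by
  intro g hg
  by_contra hne
  obtain ⟨p, hp, q, hq, rfl⟩ := HahnSeries.support_mul_subset
    ((HahnSeries.mem_support _ _).2 hne)
  have : p = g₀ := by
    by_contra hp'
    exact hp (HahnSeries.coeff_single_of_ne hp')
  subst this
  exact h q (ha q hq) hg

end Support

section PartialFractions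

variable {F : Type*} [Field F]

/-- Congruence of two elements of a subring `P` modulo the ideal `(t - y) P`. -/
def CongMod (P : Subring F) (t y a b : F) : Prop :=
  a ∈ P ∧ b ∈ P ∧ ∃ q ∈ P, a - b = (t - y) * q

namespace CongMod

variable {P : Subring F} {t y a b c d : F}

theorem refl (ha : a ∈ P) : CongMod P t y a a := ⟨ha, ha, 0, P.zero_mem, by ring⟩

theorem base (ht : t ∈ P) (hy : y ∈ P) : CongMod P t y t y :=
  ⟨ht, hy, 1, P.one_mem, by ring⟩

theorem add (h : CongMod P t y a b) (h' : CongMod P t y c d) :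
    CongMod P t y (a + c) (b + d) := by
  obtain ⟨ha, hb, q, hq, e⟩ := h
  obtain ⟨hc, hd, q', hq', e'⟩ := h'
  exact ⟨P.add_mem ha hc, P.add_mem hb hd, q + q', P.add_mem hq hq', by
    linear_combination e + e'⟩

theorem mul (h : CongMod P t y a b) (h' : CongMod P t y c d) :
    CongMod P t y (a * c) (b * d) := by
  obtain ⟨ha, hb, q, hq, e⟩ := h
  obtain ⟨hc, hd, q', hq', e'⟩ := h'
  exact ⟨P.mul_mem ha hc, P.mul_mem hb hd, q * c + b * q',
    P.add_mem (P.mul_mem hq hc) (P.mul_mem hb hq'), by linear_combination c * e + b * e'⟩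

theorem sub (h : CongMod P t y a b) (h' : CongMod P t y c d) :
    CongMod P t y (a - c) (b - d) := by
  obtain ⟨ha, hb, q, hq, e⟩ := h
  obtain ⟨hc, hd, q', hq', e'⟩ := h'
  exact ⟨P.sub_mem ha hc, P.sub_mem hb hd, q - q', P.sub_mem hq hq', by
    linear_combination e - e'⟩

theorem pow (h : CongMod P t y a b) (k : ℕ) : CongMod P t y (a ^ k) (b ^ k) := by
  induction k with
  | zero => simpa using refl P.one_mem
  | succ k ih => simpa only [pow_succ] using ih.mul h

theorem inv (h : CongMod P t y a b) (ha : a⁻¹ ∈ P) (hb : b⁻¹ ∈ P) (ha0 : a ≠ 0)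
    (hb0 : b ≠ 0) : CongMod P t y a⁻¹ b⁻¹ := by
  obtain ⟨-, -, q, hq, e⟩ := h
  refine ⟨ha, hb, -(q * (a⁻¹ * b⁻¹)), P.neg_mem (P.mul_mem hq (P.mul_mem ha hb)), ?_⟩
  field_simp
  linear_combination -e

theorem prod {ι : Type*} {s : Finset ι} {f g : ι → F}
    (h : ∀ i ∈ s, CongMod P t y (f i) (g i)) :
    CongMod P t y (∏ i ∈ s, f i) (∏ i ∈ s, g i) := by
  classical
  induction s using Finset.induction_on with
  | empty => simpa using refl P.one_mem
  | insert i s hi ih =>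
    rw [Finset.prod_insert hi, Finset.prod_insert hi]
    exact (h i (by simp)).mul (ih fun k hk => h k (by simp [hk]))

theorem sum {ι : Type*} {s : Finset ι} {f g : ι → F}
    (h : ∀ i ∈ s, CongMod P t y (f i) (g i)) :
    CongMod P t y (∑ i ∈ s, f i) (∑ i ∈ s, g i) := by
  classical
  induction s using Finset.induction_on with
  | empty => simpa using refl P.zero_mem
  | insert i s hi ih =>
    rw [Finset.sum_insert hi, Finset.sum_insert hi]
    exact (h i (by simp)).add (ih fun k hk => h k (by simp [hk]))

end CongMod

theorem lagrange_congMod {ι : Type*} [DecidableEq ι] {P : Subring F} {S : Finset ι} {y : ι → F}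
    {t : F} (ht : t ∈ P) (hy : ∀ i ∈ S, y i ∈ P)
    (hinv : ∀ i ∈ S, ∀ j ∈ S, i ≠ j → y i - y j ≠ 0 ∧ (y i - y j)⁻¹ ∈ P)
    {m : ι → F} (hm : ∀ i ∈ S, m i ∈ P) {j : ι} (hj : j ∈ S) :
    CongMod P t (y j) (∑ i ∈ S, m i * ∏ k ∈ S.erase i, ((t - y k) * (y i - y k)⁻¹)) (m j) := by
  rw [show m j = ∑ i ∈ S, if i = j then m j else 0 by simp [hj]]
  refine CongMod.sum fun i hi => ?_
  have key : ∀ k ∈ S.erase i, CongMod P t (y j) ((t - y k) * (y i - y k)⁻¹)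
      ((y j - y k) * (y i - y k)⁻¹) := fun k hk =>
    ((CongMod.base ht (hy j hj)).sub (.refl (hy k (mem_of_mem_erase hk)))).mul
      (.refl (hinv i hi k (mem_of_mem_erase hk) (ne_of_mem_erase hk).symm).2)
  have h := (CongMod.refl (t := t) (y := y j) (hm i hi)).mul (CongMod.prod key)
  split_ifs with hij
  · subst hij
    rwa [Finset.prod_eq_one (s := S.erase i) (f := fun k => (y i - y k) * (y i - y k)⁻¹) fun k hk =>
      mul_inv_cancel₀ (hinv i hi k (mem_of_mem_erase hk) (ne_of_mem_erase hk).symm).1,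
      mul_one] at h
  · rwa [Finset.prod_eq_zero (s := S.erase i) (i := j)
      (f := fun k => (y j - y k) * (y i - y k)⁻¹)
      (mem_erase.2 ⟨fun e => hij e.symm, hj⟩) (by simp), mul_zero] at h

theorem partialFractions {ι : Type*} [DecidableEq ι] {P : Subring F} {S : Finset ι} {y : ι → F}
    {t : F} (ht : t ∈ P) (hy : ∀ i ∈ S, y i ∈ P)
    (hinv : ∀ i ∈ S, ∀ j ∈ S, i ≠ j → y i - y j ≠ 0 ∧ (y i - y j)⁻¹ ∈ P)
    (hty : ∀ i ∈ S, t - y i ≠ 0)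
    {M : F} {m : ι → F} (hM : M ∈ P) (h : ∀ i ∈ S, CongMod P t (y i) M (m i)) :
    ∃ q ∈ P, M / ∏ i ∈ S, (t - y i) =
      q + ∑ i ∈ S, m i * (∏ k ∈ S.erase i, (y i - y k))⁻¹ * (t - y i)⁻¹ := by
  have hm : ∀ i ∈ S, m i ∈ P := fun i hi => (h i hi).2.1
  set L := ∑ i ∈ S, m i * ∏ k ∈ S.erase i, ((t - y k) * (y i - y k)⁻¹) with hL
  have hLP : L ∈ P := P.sum_mem fun i hi => P.mul_mem (hm i hi) (P.prod_mem fun k hk =>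
    P.mul_mem (P.sub_mem ht (hy k (mem_of_mem_erase hk)))
      (hinv i hi k (mem_of_mem_erase hk) (ne_of_mem_erase hk).symm).2)
  let f : S → P := fun i => ⟨t - y i, P.sub_mem ht (hy i i.2)⟩
  have hdvd : (∏ i : S, f i) ∣ (⟨M - L, P.sub_mem hM hLP⟩ : P) := by
    refine Fintype.prod_dvd_of_coprime ?_ ?_
    · intro i k hik
      have hne : (i : ι) ≠ k := fun e => hik (Subtype.ext e)
      obtain ⟨h0, h1⟩ := hinv i i.2 k k.2 hne
      refine ⟨-⟨_, h1⟩, ⟨_, h1⟩, Subtype.ext ?_⟩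
      simp only [f, Subring.coe_add, Subring.coe_mul, Subring.coe_neg, Subring.coe_one]
      field_simp
      ring
    · intro i
      obtain ⟨-, -, q, hq, e⟩ := h i i.2
      obtain ⟨-, -, q', hq', e'⟩ := lagrange_congMod ht hy hinv hm i.2
      refine ⟨⟨q - q', P.sub_mem hq hq'⟩, Subtype.ext ?_⟩
      simp only [f, Subring.coe_mul]
      rw [hL]
      linear_combination e - e'
  obtain ⟨q, hq⟩ := hdvd
  refine ⟨q, q.2, ?_⟩
  have hq' : M - L = (∏ i ∈ S, (t - y i)) * q := by
    have := congrArg Subtype.val hq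
    rw [Subring.coe_mul, ← P.subtype_apply (∏ i, f i), map_prod] at this
    rw [← Finset.prod_coe_sort S fun i => t - y i]
    exact this
  have h0 : ∏ i ∈ S, (t - y i) ≠ 0 := Finset.prod_ne_zero_iff.2 hty
  have hLdiv : L / ∏ i ∈ S, (t - y i) =
      ∑ i ∈ S, m i * (∏ k ∈ S.erase i, (y i - y k))⁻¹ * (t - y i)⁻¹ := by
    rw [hL, Finset.sum_div]
    refine Finset.sum_congr rfl fun i hi => ?_
    rw [← Finset.mul_prod_erase S _ hi, Finset.prod_mul_distrib, Finset.prod_inv_distrib]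
    have h1 : ∏ k ∈ S.erase i, (t - y k) ≠ 0 :=
      Finset.prod_ne_zero_iff.2 fun k hk => hty k (mem_of_mem_erase hk)
    have h2 := hty i hi
    field_simp
  rw [← hLdiv, eq_comm, ← eq_sub_iff_add_eq, ← sub_div, hq', mul_div_cancel_left₀ _ h0]

end PartialFractions

section Exponents

variable (n r : ℕ)

/-- The exponent of `u_i⁻¹` in a monomial. -/
def uDeg (i : Fin r) : Lex (Fin (r + 1) → ℤ) →+ ℤ where
  toFun g := ofLex g i.rev.succ
  map_zero' := rfl
  map_add' _ _ := rfl

/-- The monomials that do not involve any `u_i`. -/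
def constExp : AddSubgroup (Lex (Fin (r + 1) → ℤ)) := ⨅ i, (uDeg r i).ker

/-- The monomials in which `u_i` has a nonnegative exponent. -/
def uPoly (i : Fin r) : AddSubmonoid (Lex (Fin (r + 1) → ℤ)) where
  carrier := {g | uDeg r i g ≤ 0}
  add_mem' := by
    intro a b ha hb
    simp only [Set.mem_ofPred_eq, map_add] at *
    omega
  zero_mem' := by simp

/-- The monomials in which `u_i` has a nonpositive exponent. -/
def uInvPoly (i : Fin r) : AddSubmonoid (Lex (Fin (r + 1) → ℤ)) where
  carrier := {g | 0 ≤ uDeg r i g}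
  add_mem' := by
    intro a b ha hb
    simp only [Set.mem_ofPred_eq, map_add] at *
    omega
  zero_mem' := by simp

variable {n r}

theorem mem_constExp {g : Lex (Fin (r + 1) → ℤ)} : g ∈ constExp r ↔ ∀ i, uDeg r i g = 0 := by
  simp [constExp, AddSubgroup.mem_iInf, AddMonoidHom.mem_ker]

theorem constExp_le_ker (i : Fin r) : constExp r ≤ (uDeg r i).ker := iInf_le _ i

theorem ker_le_uPoly (i : Fin r) : (uDeg r i).ker.toAddSubmonoid ≤ uPoly r i :=
  fun _ hg => le_of_eq (show _ = _ from hg)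

theorem ker_le_uInvPoly (i : Fin r) : (uDeg r i).ker.toAddSubmonoid ≤ uInvPoly r i :=
  fun _ hg => ge_of_eq (show _ = _ from hg)

theorem uDeg_single_zero (i : Fin r) (c : ℤ) : uDeg r i (toLex (Pi.single 0 c)) = 0 := by
  simp [uDeg]

theorem uDeg_single_self (i : Fin r) (c : ℤ) :
    uDeg r i (toLex (Pi.single i.rev.succ c)) = c := by
  simp [uDeg]

theorem uDeg_single_of_ne {i k : Fin r} (h : i ≠ k) (c : ℤ) :
    uDeg r i (toLex (Pi.single k.rev.succ c)) = 0 := by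
  have : i.rev.succ ≠ k.rev.succ := fun e => h (Fin.rev_injective (Fin.succ_injective _ e))
  simp [uDeg, this]

theorem lex_pos {g : Fin (r + 1) → ℤ} (k : Fin (r + 1)) (h0 : ∀ j < k, g j = 0) (hk : 0 < g k) :
    0 < toLex g :=
  ⟨k, fun j hj => (h0 j hj).symm, hk⟩

theorem orderTop_single_pos {g : Lex (Fin (r + 1) → ℤ)} (hg : 0 < g) (c : K n) :
    0 < (HahnSeries.single g c).orderTop := by
  by_cases hc : c = 0
  · simp [hc]
  · rw [HahnSeries.orderTop_single hc]
    exact_mod_cast hg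

theorem orderTop_CK_mul_pos (c : K n) {a : H n r} (ha : 0 < a.orderTop) :
    0 < (CK c * a).orderTop := by
  rw [HahnSeries.C_mul_eq_smul]
  exact ha.trans_le (HahnSeries.orderTop_le_orderTop_smul _ _)

theorem orderTop_add_pos {a b : H n r} (ha : 0 < a.orderTop) (hb : 0 < b.orderTop) :
    0 < (a + b).orderTop :=
  (lt_min ha hb).trans_le HahnSeries.min_orderTop_le_orderTop_add

theorem orderTop_neg_pos {a : H n r} (ha : 0 < a.orderTop) : 0 < (-a).orderTop := by
  rwa [HahnSeries.orderTop_neg]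

theorem u_ne_zero (i : Fin r) : u n r i ≠ 0 := by simp [u]

theorem u_inv (i : Fin r) :
    (u n r i)⁻¹ = HahnSeries.single (toLex (Pi.single i.rev.succ (1 : ℤ))) 1 := by
  rw [u, HahnSeries.inv_single, ← toLex_neg, ← Pi.single_neg]
  simp

theorem CK_mem_const (c : K n) : (CK c : H n r) ∈ suppSubfield (K n) (constExp r) :=
  single_mem_suppSubring (zero_mem _) c

theorem β_mem_const : β n r ∈ suppSubfield (K n) (constExp r) :=
  single_mem_suppSubring (mem_constExp.2 fun i => uDeg_single_zero i 1) 1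

theorem const_le (i : Fin r) :
    suppSubfield (K n) (constExp r) ≤ suppSubfield (K n) (uDeg r i).ker :=
  suppSubring_mono (constExp_le_ker i)

theorem u_mem_of_ne {i k : Fin r} (h : i ≠ k) : u n r k ∈ suppSubfield (K n) (uDeg r i).ker :=
  single_mem_suppSubring (uDeg_single_of_ne h _) 1

theorem mem_uPoly_of_ker {i : Fin r} {a : H n r} (h : a ∈ suppSubfield (K n) (uDeg r i).ker) :
    a ∈ suppSubring (K n) (uPoly r i) :=
  suppSubring_mono (ker_le_uPoly i) h

theorem mem_uInvPoly_of_ker {i : Fin r} {a : H n r}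
    (h : a ∈ suppSubfield (K n) (uDeg r i).ker) : a ∈ suppSubring (K n) (uInvPoly r i) :=
  suppSubring_mono (ker_le_uInvPoly i) h

theorem u_mem_uPoly (i : Fin r) : u n r i ∈ suppSubring (K n) (uPoly r i) :=
  single_mem_suppSubring (by
    change uDeg r i _ ≤ 0
    rw [uDeg_single_self]; decide) 1

theorem orderTop_β_pos : 0 < (β n r).orderTop :=
  orderTop_single_pos (lex_pos 0 (fun j hj => absurd hj (Fin.not_lt_zero j)) (by simp)) 1

theorem orderTop_β_mul_CK_pos (c : K n) : 0 < (β n r * CK c).orderTop := by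
  rw [mul_comm]
  exact orderTop_CK_mul_pos c orderTop_β_pos

theorem orderTop_u_inv_pos (i : Fin r) : 0 < ((u n r i)⁻¹).orderTop := by
  rw [u_inv]
  refine orderTop_single_pos (lex_pos i.rev.succ (fun j hj => ?_) (by simp)) 1
  simp [hj.ne]

theorem orderTop_β_mul_u_pos (i : Fin r) : 0 < (β n r * u n r i).orderTop := by
  rw [β, u, HahnSeries.single_mul_single, ← toLex_add]
  refine orderTop_single_pos (lex_pos 0 (fun j hj => absurd hj (Fin.not_lt_zero j)) ?_) _
  simp [(Fin.succ_ne_zero _).symm]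

theorem orderTop_u_mul_u_inv_pos {i k : Fin r} (h : i < k) :
    0 < (u n r i * (u n r k)⁻¹).orderTop := by
  rw [u_inv, u, HahnSeries.single_mul_single, ← toLex_add]
  have hlt : k.rev.succ < i.rev.succ := Fin.succ_lt_succ_iff.2 (Fin.rev_lt_rev.2 h)
  refine orderTop_single_pos (lex_pos k.rev.succ (fun j hj => ?_) ?_) _
  · simp [hj.ne, (hj.trans hlt).ne]
  · simp [hlt.ne]

end Exponents

section Units

variable {n r : ℕ} {A : AddSubmonoid (Lex (Fin (r + 1) → ℤ))} {s v : H n r}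

theorem one_add_β_mul_ne_zero (h : 0 < (β n r * s).orderTop) : 1 + β n r * s ≠ 0 := by
  simpa using one_sub_ne_zero_of_orderTop_pos (orderTop_neg_pos h)

theorem inv_one_add_β_mul_mem (hs : β n r * s ∈ suppSubring (K n) A)
    (h : 0 < (β n r * s).orderTop) : (1 + β n r * s)⁻¹ ∈ suppSubring (K n) A := by
  simpa using inv_one_sub_mem_suppSubring (neg_mem hs) (orderTop_neg_pos h)

theorem two_add_β_mul_eq : 2 + β n r * s = CK 2 * (1 - -(CK 2⁻¹ * (β n r * s))) := by
  have h : (CK 2 : H n r) * CK 2⁻¹ = 1 := by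
    rw [← map_mul, mul_inv_cancel₀ two_ne_zero, map_one]
  have h2 : (CK 2 : H n r) = 2 := map_ofNat _ 2
  linear_combination -(β n r * s) * h - h2

theorem two_add_β_mul_ne_zero (h : 0 < (β n r * s).orderTop) : 2 + β n r * s ≠ 0 := by
  rw [two_add_β_mul_eq]
  refine mul_ne_zero ?_ (one_sub_ne_zero_of_orderTop_pos
    (orderTop_neg_pos (orderTop_CK_mul_pos _ h)))
  rw [Ne, map_eq_zero]
  exact two_ne_zero

theorem CK_mem_suppSubring (c : K n) : (CK c : H n r) ∈ suppSubring (K n) A :=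
  single_mem_suppSubring A.zero_mem c

theorem inv_two_add_β_mul_mem (hs : β n r * s ∈ suppSubring (K n) A)
    (h : 0 < (β n r * s).orderTop) : (2 + β n r * s)⁻¹ ∈ suppSubring (K n) A := by
  rw [two_add_β_mul_eq, mul_inv, ← map_inv₀]
  exact mul_mem (CK_mem_suppSubring _) (inv_one_sub_mem_suppSubring
    (neg_mem (mul_mem (CK_mem_suppSubring _) hs)) (orderTop_neg_pos (orderTop_CK_mul_pos _ h)))

theorem fplus_eq_mul_one_sub (hv : v ≠ 0) :
    fplus n r v s = v * (1 - -(s * v⁻¹ + β n r * s)) := by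
  rw [fplus]
  field_simp
  ring

theorem fplus_ne_zero (hv : v ≠ 0) (h : 0 < (β n r * s).orderTop)
    (h' : 0 < (s * v⁻¹).orderTop) : fplus n r v s ≠ 0 := by
  rw [fplus_eq_mul_one_sub hv]
  exact mul_ne_zero hv (one_sub_ne_zero_of_orderTop_pos
    (orderTop_neg_pos (orderTop_add_pos h' h)))

theorem inv_fplus_mem (hv : v ≠ 0) (hvA : v⁻¹ ∈ suppSubring (K n) A)
    (hsA : s ∈ suppSubring (K n) A) (hs : β n r * s ∈ suppSubring (K n) A)
    (h : 0 < (β n r * s).orderTop) (h' : 0 < (s * v⁻¹).orderTop) :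
    (fplus n r v s)⁻¹ ∈ suppSubring (K n) A := by
  rw [fplus_eq_mul_one_sub hv, mul_inv]
  exact mul_mem hvA (inv_one_sub_mem_suppSubring
    (neg_mem (add_mem (mul_mem hsA hvA) hs)) (orderTop_neg_pos (orderTop_add_pos h' h)))

theorem sub_ne_zero_of_orderTop (hv : v ≠ 0) (h' : 0 < (s * v⁻¹).orderTop) : v - s ≠ 0 := by
  have e : v - s = v * (1 - s * v⁻¹) := by field_simp
  rw [e]
  exact mul_ne_zero hv (one_sub_ne_zero_of_orderTop_pos h')

end Units

section Kernels

variable (n r : ℕ)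

/-- The factor of the generating function that involves a single `u_i`. -/
def oneKernel (S : Finset (Fin n)) (s : H n r) : H n r :=
  (2 + β n r * s)⁻¹ * (1 + β n r * s)⁻¹ *
    ∏ j ∈ S, fplus n r s (CK (x n j)) / fminus n r s (CK (x n j))

/-- The factor of the generating function that involves a pair of variables `u_i`, `u_j`. -/
def pairKernel (v s : H n r) : H n r := fminus n r v s / fplus n r v s

/-- The generating function in the variables `x_j`, `j ∈ S`, and `u_{e(i)}`, multiplied by the
monomial `∏ u_{e(i)}^{ν_i}`. -/
def shiftedGenFun {k : ℕ} (e : Fin k → Fin r) (ν : Fin k → ℕ) (S : Finset (Fin n)) : H n r :=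
  (∏ i, (u n r (e i) ^ ν i * oneKernel n r S (u n r (e i)))) *
    ∏ i, ∏ j ∈ Finset.Ioi i, pairKernel n r (u n r (e j)) (u n r (e i))

/-- The numerator of the generating function viewed as a function of its first variable. -/
def numer {k : ℕ} (m : ℕ) (S : Finset (Fin n)) (V : Fin k → H n r) (s : H n r) : H n r :=
  s ^ m * ((2 + β n r * s)⁻¹ * (1 + β n r * s)⁻¹) *
    (∏ j ∈ S, fplus n r s (CK (x n j)) * (1 + β n r * CK (x n j))) *
    ∏ i, (V i - s) * (1 + β n r * s)⁻¹ * (fplus n r (V i) s)⁻¹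

/-- The weight of choosing the variable `x_j` first among `x_k`, `k ∈ S`. -/
def firstWeight (m : ℕ) (S : Finset (Fin n)) (j : Fin n) : H n r :=
  CK (x n j) ^ m *
    ∏ k ∈ S.erase j, fplus n r (CK (x n j)) (CK (x n k)) / fminus n r (CK (x n j)) (CK (x n k))

variable {n r}

theorem shiftedGenFun_succ {k : ℕ} (e : Fin (k + 1) → Fin r) (ν : Fin (k + 1) → ℕ)
    (S : Finset (Fin n)) :
    shiftedGenFun n r e ν S =
      u n r (e 0) ^ ν 0 * oneKernel n r S (u n r (e 0)) *
        (∏ i : Fin k, pairKernel n r (u n r (e i.succ)) (u n r (e 0))) *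
        shiftedGenFun n r (fun i => e i.succ) (fun i => ν i.succ) S := by
  simp only [shiftedGenFun, Fin.prod_univ_succ, Fin.prod_Ioi_zero, Fin.prod_Ioi_succ]
  ring

theorem oneKernel_mul_pairKernel {k : ℕ} (m : ℕ) (S : Finset (Fin n)) (V : Fin k → H n r)
    (s : H n r) :
    s ^ (m + 1) * oneKernel n r S s * ∏ i, pairKernel n r (V i) s =
      s * (numer n r m S V s / ∏ j ∈ S, (s - CK (x n j))) := by
  have h1 : ∏ j ∈ S, fplus n r s (CK (x n j)) / fminus n r s (CK (x n j)) =
      (∏ j ∈ S, fplus n r s (CK (x n j)) * (1 + β n r * CK (x n j))) /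
        ∏ j ∈ S, (s - CK (x n j)) := by
    rw [← Finset.prod_div_distrib]
    refine Finset.prod_congr rfl fun j _ => ?_
    rw [fminus, div_div_eq_mul_div]
  have h2 : ∏ i, pairKernel n r (V i) s =
      ∏ i, (V i - s) * (1 + β n r * s)⁻¹ * (fplus n r (V i) s)⁻¹ := by
    simp only [pairKernel, fminus, div_eq_mul_inv]
  rw [oneKernel, numer, h1, h2]
  ring

theorem fplus_div_fminus_mul {n r : ℕ} {v s : H n r} (h1 : 1 + β n r * s ≠ 0)
    (h2 : v - s ≠ 0) (h3 : fplus n r v s ≠ 0) :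
    (v - s) * (1 + β n r * s)⁻¹ * (fplus n r v s)⁻¹ * (fplus n r v s / fminus n r v s) = 1 := by
  rw [fminus]
  generalize 1 + β n r * s = b at *
  field_simp

theorem numer_CK_mul {k : ℕ} (m : ℕ) (S : Finset (Fin n)) (V : Fin k → H n r) {j : Fin n}
    (hj : j ∈ S) (h2 : ∀ i, V i - CK (x n j) ≠ 0) (h3 : ∀ i, fplus n r (V i) (CK (x n j)) ≠ 0) :
    numer n r m S V (CK (x n j)) *
        (∏ l ∈ S.erase j, ((CK (x n j) : H n r) - CK (x n l)))⁻¹ *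
        ∏ i, oneKernel n r S (V i) =
      firstWeight n r (m + 1) S j * ∏ i, oneKernel n r (S.erase j) (V i) := by
  have hb := orderTop_β_mul_CK_pos (r := r) (x n j)
  have e1 := one_add_β_mul_ne_zero hb
  have e2 := two_add_β_mul_ne_zero hb
  have hW : ∏ l ∈ S.erase j,
        fplus n r (CK (x n j)) (CK (x n l)) / fminus n r (CK (x n j)) (CK (x n l)) =
      (∏ l ∈ S.erase j, fplus n r (CK (x n j)) (CK (x n l)) * (1 + β n r * CK (x n l))) *
        (∏ l ∈ S.erase j, ((CK (x n j) : H n r) - CK (x n l)))⁻¹ := by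
    rw [← Finset.prod_inv_distrib, ← Finset.prod_mul_distrib]
    refine Finset.prod_congr rfl fun l _ => ?_
    rw [fminus, div_div_eq_mul_div, div_eq_mul_inv]
  have hK : ∀ i, oneKernel n r S (V i) = oneKernel n r (S.erase j) (V i) *
      (fplus n r (V i) (CK (x n j)) / fminus n r (V i) (CK (x n j))) := by
    intro i
    rw [oneKernel, oneKernel, ← Finset.mul_prod_erase S _ hj]
    ring
  have hV : (∏ i, (V i - CK (x n j)) * (1 + β n r * CK (x n j))⁻¹ *
        (fplus n r (V i) (CK (x n j)))⁻¹) * ∏ i, oneKernel n r S (V i) =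
      ∏ i, oneKernel n r (S.erase j) (V i) := by
    rw [← Finset.prod_mul_distrib]
    refine Finset.prod_congr rfl fun i _ => ?_
    rw [hK i, mul_left_comm, fplus_div_fminus_mul e1 (h2 i) (h3 i), mul_one]
  have hd : fplus n r (CK (x n j)) (CK (x n j)) * (1 + β n r * CK (x n j)) *
      ((2 + β n r * CK (x n j))⁻¹ * (1 + β n r * CK (x n j))⁻¹) = CK (x n j) := by
    rw [show fplus n r (CK (x n j)) (CK (x n j)) = CK (x n j) * (2 + β n r * CK (x n j)) by
      rw [fplus]; ring]
    generalize 1 + β n r * CK (x n j) = b at *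
    generalize 2 + β n r * CK (x n j) = c at *
    field_simp
  rw [firstWeight, hW, ← hV, numer, ← Finset.mul_prod_erase S _ hj, pow_succ]
  generalize (∏ i, (V i - CK (x n j)) * (1 + β n r * CK (x n j))⁻¹ *
        (fplus n r (V i) (CK (x n j)))⁻¹) = a at *
  generalize (∏ l ∈ S.erase j, ((CK (x n j) : H n r) - CK (x n l)))⁻¹ = b at *
  generalize (∏ l ∈ S.erase j, fplus n r (CK (x n j)) (CK (x n l)) *
    (1 + β n r * CK (x n l))) = c at *
  generalize (∏ i, oneKernel n r S (V i)) = d at *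
  linear_combination (CK (x n j) ^ m * c * a * b * d) * hd

theorem x_injective : Function.Injective (x n) :=
  (IsFractionRing.injective (MvPolynomial (Fin n) ℚ) (K n)).comp MvPolynomial.X_injective

end Kernels

section Step

variable {n r : ℕ}

theorem fplus_mem {L : Subring (H n r)} {a b : H n r} (hβ : β n r ∈ L) (ha : a ∈ L)
    (hb : b ∈ L) : fplus n r a b ∈ L :=
  add_mem (add_mem ha hb) (mul_mem (mul_mem hβ ha) hb)

theorem fplus_mem_subfield {L : Subfield (H n r)} {a b : H n r} (hβ : β n r ∈ L) (ha : a ∈ L)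
    (hb : b ∈ L) : fplus n r a b ∈ L :=
  add_mem (add_mem ha hb) (mul_mem (mul_mem hβ ha) hb)

theorem fminus_mem_subfield {L : Subfield (H n r)} {a b : H n r} (hβ : β n r ∈ L) (ha : a ∈ L)
    (hb : b ∈ L) : fminus n r a b ∈ L :=
  div_mem (sub_mem ha hb) (add_mem (one_mem _) (mul_mem hβ hb))

theorem CongMod.fplus {P : Subring (H n r)} {t y a b c d : H n r} (hβ : β n r ∈ P)
    (h : CongMod P t y a b) (h' : CongMod P t y c d) :
    CongMod P t y (fplus n r a c) (fplus n r b d) :=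
  (h.add h').add (((CongMod.refl hβ).mul h).mul h')

theorem firstWeight_mem_const (m : ℕ) (S : Finset (Fin n)) (j : Fin n) :
    firstWeight n r m S j ∈ suppSubfield (K n) (constExp r) :=
  mul_mem (pow_mem (CK_mem_const _) _) (prod_mem fun _ _ =>
    div_mem (fplus_mem_subfield β_mem_const (CK_mem_const _) (CK_mem_const _))
      (fminus_mem_subfield β_mem_const (CK_mem_const _) (CK_mem_const _)))

theorem shiftedGenFun_mem_ker {k : ℕ} {i : Fin r} (e : Fin k → Fin r) (he : ∀ l, i ≠ e l)
    (ν : Fin k → ℕ) (S : Finset (Fin n)) :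
    shiftedGenFun n r e ν S ∈ suppSubfield (K n) (uDeg r i).ker := by
  have hβ := const_le (n := n) i β_mem_const
  have hC := fun c : K n => const_le (r := r) i (CK_mem_const c)
  have hu := fun l => u_mem_of_ne (n := n) (he l)
  refine mul_mem (prod_mem fun l _ => mul_mem (pow_mem (hu l) _) (mul_mem (mul_mem
    (inv_mem ?_) (inv_mem (add_mem (one_mem _) (mul_mem hβ (hu l))))) (prod_mem fun j _ =>
      div_mem (fplus_mem_subfield hβ (hu l) (hC _)) (fminus_mem_subfield hβ (hu l) (hC _)))))
    (prod_mem fun l _ => prod_mem fun l' _ =>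
      div_mem (fminus_mem_subfield hβ (hu l') (hu l)) (fplus_mem_subfield hβ (hu l') (hu l)))
  exact add_mem (ofNat_mem _ 2) (mul_mem hβ (hu l))

theorem numer_congMod {k : ℕ} {i : Fin r} (e : Fin k → Fin r) (he : ∀ l, i < e l) (m : ℕ)
    (S : Finset (Fin n)) (c : K n) :
    CongMod (suppSubring (K n) (uPoly r i)) (u n r i) (CK c)
      (numer n r m S (fun l => u n r (e l)) (u n r i))
      (numer n r m S (fun l => u n r (e l)) (CK c)) := by
  set P := suppSubring (K n) (uPoly r i)
  have hβ : β n r ∈ P := mem_uPoly_of_ker (const_le i β_mem_const)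
  have hC := fun a : K n => (CK_mem_suppSubring a : (CK a : H n r) ∈ P)
  have hu : u n r i ∈ P := u_mem_uPoly i
  have hv := fun l => (mem_uPoly_of_ker (u_mem_of_ne (he l).ne) : u n r (e l) ∈ P)
  have hv' := fun l =>
    (mem_uPoly_of_ker (inv_mem (u_mem_of_ne (he l).ne)) : (u n r (e l))⁻¹ ∈ P)
  have hpu := orderTop_β_mul_u_pos (n := n) i
  have hpx := orderTop_β_mul_CK_pos (r := r) c
  have hpu' := fun l => orderTop_u_mul_u_inv_pos (n := n) (he l)
  have hpx' := fun l => orderTop_CK_mul_pos c (orderTop_u_inv_pos (e l))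
  have b : CongMod P (u n r i) (CK c) (u n r i) (CK c) := .base hu (hC _)
  have hβs := (CongMod.refl hβ).mul b
  have h1 := ((CongMod.refl P.one_mem).add hβs).inv
    (inv_one_add_β_mul_mem (mul_mem hβ hu) hpu) (inv_one_add_β_mul_mem (mul_mem hβ (hC _)) hpx)
    (one_add_β_mul_ne_zero hpu) (one_add_β_mul_ne_zero hpx)
  have h2 := ((CongMod.refl (ofNat_mem P 2)).add hβs).inv
    (inv_two_add_β_mul_mem (mul_mem hβ hu) hpu) (inv_two_add_β_mul_mem (mul_mem hβ (hC _)) hpx)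
    (two_add_β_mul_ne_zero hpu) (two_add_β_mul_ne_zero hpx)
  refine (((b.pow m).mul (h2.mul h1)).mul (CongMod.prod fun l _ =>
    (b.fplus hβ (.refl (hC _))).mul (.refl (add_mem (one_mem _) (mul_mem hβ (hC _)))))).mul
    (CongMod.prod fun l _ => (((CongMod.refl (hv l)).sub b).mul h1).mul ?_)
  exact (CongMod.fplus hβ (.refl (hv l)) b).inv
    (inv_fplus_mem (u_ne_zero _) (hv' l) hu (mul_mem hβ hu) hpu (hpu' l))
    (inv_fplus_mem (u_ne_zero _) (hv' l) (hC _) (mul_mem hβ (hC _)) hpx (hpx' l))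
    (fplus_ne_zero (u_ne_zero _) hpu (hpu' l)) (fplus_ne_zero (u_ne_zero _) hpx (hpx' l))

theorem u_sub_CK_eq (i : Fin r) (c : K n) :
    u n r i - CK c = u n r i * (1 - CK c * (u n r i)⁻¹) := by
  have := u_ne_zero (n := n) i
  field_simp

theorem u_sub_CK_ne_zero (i : Fin r) (c : K n) : u n r i - CK c ≠ 0 :=
  sub_ne_zero_of_orderTop (u_ne_zero i) (orderTop_CK_mul_pos c (orderTop_u_inv_pos i))

theorem offSupport_mul_inv_u_sub {i : Fin r} {a : H n r} (c : K n)
    (ha : a ∈ suppSubring (K n) (uInvPoly r i)) :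
    OffSupport (constExp r) (a * (u n r i - CK c)⁻¹) := by
  have hinv : (u n r i)⁻¹ ∈ suppSubring (K n) (uInvPoly r i) := by
    rw [u_inv]
    refine single_mem_suppSubring ?_ 1
    change 0 ≤ uDeg r i _
    rw [uDeg_single_self]; decide
  have h : (1 - CK c * (u n r i)⁻¹)⁻¹ ∈ suppSubring (K n) (uInvPoly r i) :=
    inv_one_sub_mem_suppSubring (mul_mem (CK_mem_suppSubring c) hinv)
      (orderTop_CK_mul_pos c (orderTop_u_inv_pos i))
  rw [u_sub_CK_eq, mul_inv, mul_left_comm, u_inv]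
  rw [u_inv] at h
  refine offSupport_single_mul (fun b hb hmem => ?_) (mul_mem ha h)
  have h0 := mem_constExp.1 hmem i
  rw [map_add, uDeg_single_self] at h0
  have hb' : 0 ≤ uDeg r i b := hb
  omega

theorem offSupport_u_mul {i : Fin r} {a : H n r} (ha : a ∈ suppSubring (K n) (uPoly r i)) :
    OffSupport (constExp r) (u n r i * a) := by
  refine offSupport_single_mul (fun b hb hmem => ?_) ha
  have h0 := mem_constExp.1 hmem i
  rw [map_add, uDeg_single_self] at h0
  have hb' : uDeg r i b ≤ 0 := hb
  omega

/-- Extraction of the constant term with respect to the first variable `u_{e(0)}`. -/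
theorem offSupport_shiftedGenFun_succ {k : ℕ} (e : Fin (k + 1) → Fin r) (he : StrictMono e)
    (ν : Fin (k + 1) → ℕ) (hν : 0 < ν 0) (S : Finset (Fin n)) :
    OffSupport (constExp r) (shiftedGenFun n r e ν S -
      ∑ j ∈ S, firstWeight n r (ν 0) S j *
        shiftedGenFun n r (fun i => e i.succ) (fun i => ν i.succ) (S.erase j)) := by
  obtain ⟨m, hm⟩ : ∃ m, ν 0 = m + 1 := ⟨ν 0 - 1, by omega⟩
  have hlt : ∀ l : Fin k, e 0 < e l.succ := fun l => he (Fin.succ_pos l)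
  set P := suppSubring (K n) (uPoly r (e 0)) with hP
  set V : Fin k → H n r := fun l => u n r (e l.succ) with hV
  set t := u n r (e 0) with ht
  have hC := fun c : K n => (CK_mem_suppSubring c : (CK c : H n r) ∈ P)
  have hcong := fun c => numer_congMod (fun l => e (Fin.succ l)) hlt m S c
  obtain ⟨q, hq, hqe⟩ := partialFractions (P := P) (S := S) (y := fun j => CK (x n j)) (t := t)
    (M := numer n r m S V t) (m := fun j => numer n r m S V (CK (x n j)))
    (u_mem_uPoly _) (fun _ _ => hC _) (fun i _ j _ hij => by
      rw [← map_sub, ← map_inv₀]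
      refine ⟨?_, hC _⟩
      rw [Ne, map_eq_zero, sub_eq_zero]
      exact x_injective.ne hij) (fun j _ => u_sub_CK_ne_zero _ _)
    (hcong 0).1 (fun j _ => hcong (x n j))
  set G := fun T => shiftedGenFun n r (fun i => e (Fin.succ i)) (fun i => ν (Fin.succ i)) T with hG
  have hGmem : ∀ T, G T ∈ suppSubfield (K n) (uDeg r (e 0)).ker := fun T =>
    shiftedGenFun_mem_ker _ (fun l => (hlt l).ne) _ _
  have hterm : ∀ j ∈ S, numer n r m S V (CK (x n j)) *
      (∏ l ∈ S.erase j, ((CK (x n j) : H n r) - CK (x n l)))⁻¹ * G S =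
      firstWeight n r (m + 1) S j * G (S.erase j) := by
    intro j hj
    have hpx := orderTop_β_mul_CK_pos (r := r) (x n j)
    have hpx' := fun l : Fin k => orderTop_CK_mul_pos (x n j) (orderTop_u_inv_pos (e l.succ))
    have := numer_CK_mul m S V hj (fun l => u_sub_CK_ne_zero _ _)
      (fun l => fplus_ne_zero (u_ne_zero _) hpx (hpx' l))
    simp only [hG, shiftedGenFun, Finset.prod_mul_distrib]
    linear_combination ((∏ i : Fin k, u n r (e i.succ) ^ ν i.succ) *
      ∏ i : Fin k, ∏ j ∈ Finset.Ioi i, pairKernel n r (u n r (e j.succ)) (u n r (e i.succ))) * this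
  have hmain : shiftedGenFun n r e ν S - ∑ j ∈ S, firstWeight n r (ν 0) S j * G (S.erase j) =
      t * (q * G S) + ∑ j ∈ S, CK (x n j) * (firstWeight n r (ν 0) S j * G (S.erase j)) *
        (t - CK (x n j))⁻¹ := by
    rw [shiftedGenFun_succ, hm, oneKernel_mul_pairKernel, hqe, sub_eq_iff_eq_add, add_assoc,
      ← Finset.sum_add_distrib, mul_add, add_mul, mul_assoc t q, Finset.mul_sum, Finset.sum_mul]
    congr 1
    refine Finset.sum_congr rfl fun j hj => ?_
    have h0 : t - CK (x n j) ≠ 0 := u_sub_CK_ne_zero _ _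
    rw [← hterm j hj]
    field_simp
    ring
  rw [hmain]
  refine (offSupport_u_mul (mul_mem hq (mem_uPoly_of_ker (hGmem S)))).add (.sum fun j _ =>
    offSupport_mul_inv_u_sub _ (mul_mem (CK_mem_suppSubring _) (mem_uInvPoly_of_ker
      (mul_mem (const_le _ (firstWeight_mem_const _ _ _)) (hGmem _)))))

end Step

section Combinatorics

variable {n r : ℕ}

/-- The sum, over all ways to choose successively `k` distinct elements of `S`, of the products of
the corresponding weights. -/
def choiceSum (n r : ℕ) {k : ℕ} (ν : Fin k → ℕ) (S : Finset (Fin n)) : H n r :=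
  ∑ f : Fin k → Fin n with Function.Injective f ∧ ∀ i, f i ∈ S,
    ∏ i, firstWeight n r (ν i) (S \ (Finset.Iio i).image f) (f i)

theorem image_cons_Iio_succ {k : ℕ} (j : Fin n) (f : Fin k → Fin n) (i : Fin k) :
    (Finset.Iio i.succ).image (Fin.cons j f : Fin (k + 1) → Fin n) =
      insert j ((Finset.Iio i).image f) := by
  ext a
  simp only [Finset.mem_image, Finset.mem_Iio, Finset.mem_insert, Fin.exists_fin_succ,
    Fin.cons_zero, Fin.cons_succ, Fin.succ_lt_succ_iff, Fin.succ_pos, true_and, eq_comm]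

theorem choiceSum_succ {k : ℕ} (ν : Fin (k + 1) → ℕ) (S : Finset (Fin n)) :
    choiceSum n r ν S = ∑ j ∈ S, firstWeight n r (ν 0) S j *
      choiceSum n r (fun i => ν i.succ) (S.erase j) := by
  simp only [choiceSum, Finset.mul_sum, Finset.sum_sigma']
  symm
  refine Finset.sum_bij' (fun p _ => (Fin.cons p.1 p.2 : Fin (k + 1) → Fin n))
    (fun f _ => ⟨f 0, fun i => f i.succ⟩) ?_ ?_ ?_ ?_ ?_
  · rintro ⟨j, f⟩ h
    simp only [Finset.mem_sigma, Finset.mem_filter, Finset.mem_univ, true_and,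
      Finset.mem_erase] at h
    simp only [Finset.mem_filter, Finset.mem_univ, true_and, Fin.cons_injective_iff,
      Set.mem_range, not_exists, Fin.forall_fin_succ, Fin.cons_zero, Fin.cons_succ]
    exact ⟨⟨fun i => (h.2.2 i).1, h.2.1⟩, h.1, fun i => (h.2.2 i).2⟩
  · intro f h
    simp only [Finset.mem_filter, Finset.mem_univ, true_and] at h
    simp only [Finset.mem_sigma, Finset.mem_filter, Finset.mem_univ, true_and,
      Finset.mem_erase]
    exact ⟨h.2 0, h.1.comp (Fin.succ_injective _),
      fun i => ⟨h.1.ne (Fin.succ_ne_zero i), h.2 _⟩⟩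
  · rintro ⟨j, f⟩ _
    rfl
  · intro f _
    exact Fin.cons_self_tail f
  · rintro ⟨j, f⟩ _
    rw [Fin.prod_univ_succ]
    congr 1
    · have h0 : Finset.Iio (0 : Fin (k + 1)) = ∅ := by ext; simp
      simp [h0]
    · refine Finset.prod_congr rfl fun i _ => ?_
      rw [image_cons_Iio_succ, Fin.cons_succ, Finset.sdiff_insert, Finset.erase_sdiff_comm]

theorem Cperm_ext (hrn : r ≤ n) {w w' : Equiv.Perm (Fin n)} (hw : w ∈ Cperm r n)
    (hw' : w' ∈ Cperm r n) (h : ∀ i : Fin r, w (Fin.castLE hrn i) = w' (Fin.castLE hrn i)) :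
    w = w' := by
  simp only [Cperm, Finset.mem_filter, Finset.mem_univ, true_and] at hw hw'
  have hlow : ∀ i : Fin n, (i : ℕ) < r → w i = w' i := fun i hi => h ⟨i, hi⟩
  have hrange : ∀ v v' : Equiv.Perm (Fin n), (∀ i : Fin n, (i : ℕ) < r → v i = v' i) →
      Set.range (fun i : {i : Fin n // r ≤ (i : ℕ)} => v i) ⊆
        Set.range (fun i : {i : Fin n // r ≤ (i : ℕ)} => v' i) := by
    rintro v v' hv _ ⟨i, rfl⟩
    refine ⟨⟨v'.symm (v i), ?_⟩, by simp⟩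
    by_contra hlt
    have h1 := hv _ (not_le.1 hlt)
    rw [Equiv.apply_symm_apply] at h1
    exact hlt ((v.injective h1).symm ▸ i.2)
  have key : (fun i : {i : Fin n // r ≤ (i : ℕ)} => w i) =
      fun i : {i : Fin n // r ≤ (i : ℕ)} => w' i :=
    (StrictMono.range_inj (fun i j hij => hw i.1 j.1 i.2 hij)
      (fun i j hij => hw' i.1 j.1 i.2 hij)).1
      ((hrange w w' hlow).antisymm (hrange w' w fun i hi => (hlow i hi).symm))
  ext1 i
  by_cases hi : (i : ℕ) < r
  · exact hlow i hi
  · exact congrFun key ⟨i, not_lt.1 hi⟩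

theorem exists_mem_Cperm (hrn : r ≤ n) {f : Fin r → Fin n} (hf : Function.Injective f) :
    ∃ w ∈ Cperm r n, ∀ i, w (Fin.castLE hrn i) = f i := by
  have hcard : ((Finset.univ.image f)ᶜ).card = n - r := by
    rw [Finset.card_compl, Finset.card_image_of_injective _ hf]
    simp
  let g := ((Finset.univ.image f)ᶜ).orderEmbOfFin hcard
  have hg : ∀ a b, g a ≠ f b := fun a b hab => by
    have := Finset.orderEmbOfFin_mem _ hcard a
    rw [Finset.mem_compl] at this
    exact this (Finset.mem_image.2 ⟨b, Finset.mem_univ _, hab.symm⟩)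
  let v : Fin n → Fin n := fun i =>
    if h : (i : ℕ) < r then f ⟨i, h⟩ else g ⟨i - r, by omega⟩
  have hv : Function.Injective v := by
    intro i j hij
    simp only [v] at hij
    split_ifs at hij with h1 h2 h2
    · exact Fin.ext (Fin.mk.inj_iff.1 (hf hij))
    · exact absurd hij.symm (hg _ _)
    · exact absurd hij (hg _ _)
    · have := Fin.mk.inj_iff.1 (g.injective hij)
      omega
  refine ⟨Equiv.ofBijective v (Finite.injective_iff_bijective.1 hv), ?_, fun i => ?_⟩
  · simp only [Cperm, Finset.mem_filter, Finset.mem_univ, true_and, Equiv.ofBijective_apply]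
    intro i j hi hij
    have hj : r ≤ (j : ℕ) := hi.trans hij.le
    simp only [v, not_lt.2 hi, not_lt.2 hj, dite_false]
    refine g.strictMono ?_
    rw [Fin.mk_lt_mk]
    omega
  · simp [v]

theorem image_perm_Ioi (hrn : r ≤ n) (w : Equiv.Perm (Fin n)) (i : Fin r) :
    (Finset.Ioi (Fin.castLE hrn i)).image w =
      (Finset.univ \ (Finset.Iio i).image fun k => w (Fin.castLE hrn k)).erase
        (w (Fin.castLE hrn i)) := by
  ext a
  obtain ⟨b, rfl⟩ := w.surjective a
  simp only [Finset.mem_image, Finset.mem_Ioi, EmbeddingLike.apply_eq_iff_eq, exists_eq_right,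
    Finset.mem_erase, Finset.mem_sdiff, Finset.mem_univ, true_and, Finset.mem_Iio, not_exists,
    not_and]
  constructor
  · intro h
    refine ⟨w.injective.ne h.ne', fun k hk e => ?_⟩
    subst e
    exact absurd (h : (i : ℕ) < k) (not_lt.2 (le_of_lt hk))
  · rintro ⟨h1, h2⟩
    by_contra h
    have hb : (b : ℕ) < i := lt_of_le_of_ne (not_lt.1 h) fun e =>
      h1 (congrArg w (Fin.ext e))
    exact h2 ⟨b, hb.trans i.2⟩ hb rfl

theorem sum_Cperm_eq_choiceSum (hrn : r ≤ n) (ν : Fin r → ℕ) :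
    (∑ w ∈ Cperm r n,
      (∏ i : Fin r, (CK (x n (w (Fin.castLE hrn i))) : H n r) ^ (ν i)) *
      (∏ i : Fin r, ∏ j ∈ Finset.Ioi (Fin.castLE hrn i),
          fplus n r (CK (x n (w (Fin.castLE hrn i)))) (CK (x n (w j))) /
          fminus n r (CK (x n (w (Fin.castLE hrn i)))) (CK (x n (w j))))) =
    choiceSum n r ν Finset.univ := by
  rw [choiceSum]
  refine Finset.sum_bij (fun w _ i => w (Fin.castLE hrn i)) ?_ ?_ ?_ ?_
  · intro w _
    simp only [Finset.mem_filter, Finset.mem_univ, true_and, implies_true, and_true]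
    exact w.injective.comp (Fin.castLE_injective hrn)
  · exact fun w hw w' hw' h => Cperm_ext hrn hw hw' (congrFun h)
  · intro f hf
    obtain ⟨w, hw, h⟩ := exists_mem_Cperm hrn (Finset.mem_filter.1 hf).2.1
    exact ⟨w, hw, funext h⟩
  · intro w _
    rw [← Finset.prod_mul_distrib]
    refine Finset.prod_congr rfl fun i _ => ?_
    rw [firstWeight, ← image_perm_Ioi, Finset.prod_image w.injective.injOn]

theorem offSupport_shiftedGenFun_sub_choiceSum {k : ℕ} (e : Fin k → Fin r) (he : StrictMono e)
    (ν : Fin k → ℕ) (hν : ∀ i, 0 < ν i) (S : Finset (Fin n)) :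
    OffSupport (constExp r) (shiftedGenFun n r e ν S - choiceSum n r ν S) := by
  induction k generalizing S with
  | zero =>
    have : shiftedGenFun n r e ν S - choiceSum n r ν S = 0 := by
      simp [shiftedGenFun, choiceSum, Function.injective_of_subsingleton]
    intro g _
    simp [this]
  | succ k ih =>
    have h : shiftedGenFun n r e ν S - choiceSum n r ν S =
        (shiftedGenFun n r e ν S - ∑ j ∈ S, firstWeight n r (ν 0) S j *
          shiftedGenFun n r (fun i => e i.succ) (fun i => ν i.succ) (S.erase j)) +
        ∑ j ∈ S, firstWeight n r (ν 0) S j *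
          (shiftedGenFun n r (fun i => e i.succ) (fun i => ν i.succ) (S.erase j) -
            choiceSum n r (fun i => ν i.succ) (S.erase j)) := by
      simp only [choiceSum_succ, mul_sub, Finset.sum_sub_distrib]
      ring
    rw [h]
    exact (offSupport_shiftedGenFun_succ e he ν (hν 0) S).add (.sum fun j _ =>
      .mul_left (firstWeight_mem_const _ _ _)
        (ih _ (he.comp (Fin.strictMono_succ)) _ (fun i => hν _) _))

theorem prod_u_pow (ν : Fin r → ℕ) :
    ∏ i, u n r i ^ ν i = HahnSeries.single (-eVec r 0 fun i => (ν i : ℤ)) 1 := by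
  have h : ∀ s : Finset (Fin r), ∏ i ∈ s, u n r i ^ ν i = HahnSeries.single
      (∑ i ∈ s, ν i • toLex (Pi.single (Fin.succ (Fin.rev i)) (-1 : ℤ))) 1 := by
    intro s
    induction s using Finset.induction_on with
    | empty => simp
    | insert i s hi ih =>
      rw [Finset.prod_insert hi, Finset.sum_insert hi, ih, u, HahnSeries.single_pow,
        HahnSeries.single_mul_single, one_pow, one_mul]
  rw [h]
  refine congrArg (HahnSeries.single · 1) ?_
  refine congrArg toLex (a₁ := ∑ i, ν i • Pi.single (Fin.succ (Fin.rev i)) (-1 : ℤ))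
    (a₂ := -(Fin.cases 0 fun j => (ν j.rev : ℤ) : Fin (r + 1) → ℤ)) (funext fun k => ?_)
  rw [Finset.sum_apply]
  refine Fin.cases ?_ (fun k => ?_) k
  · simp
  · rw [Finset.sum_eq_single k.rev]
    · simp
    · intro i _ hi
      have : k ≠ i.rev := fun e => hi (by simp [e])
      simp [this]
    · simp

theorem coeff_prod_u_pow_mul (ν : Fin r → ℕ) (d : ℤ) (a : H n r) :
    ((∏ i, u n r i ^ ν i) * a).coeff (eVec r d fun _ => 0) =
      a.coeff (eVec r d fun i => (ν i : ℤ)) := by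
  have h : eVec r d (fun _ => 0) =
      eVec r d (fun i => (ν i : ℤ)) + -eVec r 0 fun i => (ν i : ℤ) := by
    refine congrArg toLex (funext fun k => ?_)
    refine Fin.cases ?_ (fun k => ?_) k
    · change d = d + -0
      ring
    · change (0 : ℤ) = ν k.rev + -(ν k.rev)
      ring
  rw [prod_u_pow, h, HahnSeries.coeff_single_mul_add, one_mul]

end Combinatorics

/-- **Generating function for the `K`-theoretic `P`-polynomials (multiplicative
specialization of the universal Schur `P`-functions).**

For a strict partition `ν_1 > ⋯ > ν_r > 0` of length `r ≤ n`,
`GP_ν(x_n) = Σ_{w∈C(r,n)} w·( ∏_i x_i^{ν_i} · ∏_i ∏_{j=i+1}^n (x_i ⊕ x_j)/(x_i ⊖ x_j) )`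
equals, as an element of `Λ[[β]]` (i.e. coefficientwise in `β`), the coefficient of
`u_1^{−ν_1}⋯u_r^{−ν_r}` in
`∏_i ( (1/(2+βu_i)) (1/(1+βu_i)) ∏_{j=1}^n (u_i ⊕ x_j)/(u_i ⊖ x_j) )
  · ∏_{1≤i<j≤r} (u_j ⊖ u_i)/(u_j ⊕ u_i)`. -/
theorem K_theoretic_P_generating_function
    (n r : ℕ) (hr : 1 ≤ r) (hrn : r ≤ n)
    (nu : Fin r → ℕ) (hpos : ∀ i, 0 < nu i)
    (hstrict : ∀ i j : Fin r, i < j → nu j < nu i) :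
    ∀ d : ℤ,
    (∑ w ∈ Cperm r n,
      (∏ i : Fin r, (CK (x n (w (Fin.castLE hrn i))) : H n r) ^ (nu i)) *
      (∏ i : Fin r, ∏ j ∈ Finset.Ioi (Fin.castLE hrn i),
          fplus n r (CK (x n (w (Fin.castLE hrn i)))) (CK (x n (w j))) /
          fminus n r (CK (x n (w (Fin.castLE hrn i)))) (CK (x n (w j))))).coeff
        (eVec r d (fun _ => 0))
    =
    ((∏ i : Fin r,
        ((2 + β n r * u n r i)⁻¹ * (1 + β n r * u n r i)⁻¹ *
          ∏ j : Fin n,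
            fplus n r (u n r i) (CK (x n j)) / fminus n r (u n r i) (CK (x n j)))) *
      (∏ i : Fin r, ∏ j ∈ Finset.Ioi i,
          fminus n r (u n r j) (u n r i) / fplus n r (u n r j) (u n r i))).coeff
        (eVec r d (fun k => (nu k : ℤ))) := by
  intro d
  rw [sum_Cperm_eq_choiceSum, ← coeff_prod_u_pow_mul, ← mul_assoc, ← Finset.prod_mul_distrib,
    eq_comm, ← sub_eq_zero, ← HahnSeries.coeff_sub]
  exact offSupport_shiftedGenFun_sub_choiceSum id strictMono_id nu hpos Finset.univ _
    (mem_constExp.2 fun _ => rfl)
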